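/- arXiv:1704.00523 — 3 statements merged into one kernel-verified Lean document; each statement's English description precedes it below -/
import Mathlib

section
/- Let l ≥ 0 and l₀ > 1, and let F : 𝕋×(0,∞) → ℝ satisfy ‖F‖_{L²_{l+l₀}(Ω)} < ∞. Define V(x,η) := ∫_η^∞ F(x,s) ds. Then there is a constant C depending only on l₀ (one may take C = (2l₀−1)^{−1/2}(2l₀−2)^{−1/2}) such that ‖V‖_{L²_l(Ω)} ≤ C ‖F‖_{L²_{l+l₀}(Ω)}. -/
/-!
STATEMENT 4: the normal boundary layer component `V(x,η) := ∫_η^∞ F(x,s) ds`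
inherits weighted `L²` bounds: for `l ≥ 0`, `l₀ > 1`,
`‖V‖_{L²_l(Ω)} ≤ (2l₀−1)^{-1/2} (2l₀−2)^{-1/2} ‖F‖_{L²_{l+l₀}(Ω)}`,
where `Ω = 𝕋 × ℝ₊` (the torus is modelled by one period `x ∈ (0, 2π]`) and
`‖f‖_{L²_l(Ω)} = ‖(1+η)^l f‖_{L²(Ω)}`.
-/

noncomputable section
open MeasureTheory Set Real

/-- Squared weighted norm `‖⟨η⟩^l f‖²_{L²(𝕋×ℝ₊)}`. -/
def L2wsq (l : ℝ) (f : ℝ → ℝ → ℝ) : ℝ :=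
  ∫ x in Ioc (0:ℝ) (2*π), ∫ η in Ioi (0:ℝ), (1+η) ^ (2*l) * (f x η)^2

/-- Tail integral of a decaying power of `1 + s`. -/
theorem integral_Ioi_one_add_rpow {a : ℝ} (ha : a < -1) {c : ℝ} (hc : 0 ≤ c) :
    ∫ s in Ioi c, (1 + s) ^ a = (1 + c) ^ (a + 1) / (-(a + 1)) := by
  have h := (measurePreserving_add_left volume (1 : ℝ)).setIntegral_preimage_emb
    (MeasurableEquiv.addLeft (1 : ℝ)).measurableEmbedding (fun t => t ^ a) (Ioi (1 + c))
  rw [show (fun s : ℝ => 1 + s) ⁻¹' Ioi (1 + c) = Ioi c by ext; simp] at h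
  rw [h, integral_Ioi_rpow_of_lt ha (by linarith), div_neg, neg_div]

theorem integrableOn_Ioi_one_add_rpow {a : ℝ} (ha : a < -1) {c : ℝ} (hc : 0 ≤ c) :
    IntegrableOn (fun s : ℝ => (1 + s) ^ a) (Ioi c) := by
  simpa only [add_comm] using
    integrableOn_add_rpow_Ioi_of_lt (m := 1) ha (show -1 < c by linarith)

/-- The square form of the Cauchy-Schwarz inequality. -/
theorem sq_integral_mul_le {α : Type*} [MeasurableSpace α] {μ : Measure α} {f g : α → ℝ}
    (hf : MemLp f 2 μ) (hg : MemLp g 2 μ) :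
    (∫ a, f a * g a ∂μ) ^ 2 ≤ (∫ a, f a ^ 2 ∂μ) * ∫ a, g a ^ 2 ∂μ := by
  have hpq : (2 : ℝ).HolderConjugate 2 := ⟨by norm_num, by norm_num, by norm_num⟩
  have h := integral_mul_norm_le_Lp_mul_Lq hpq (by simpa using hf) (by simpa using hg)
  simp only [Real.norm_eq_abs, rpow_two, sq_abs, ← Real.sqrt_eq_rpow] at h
  have h' : |∫ a, f a * g a ∂μ| ≤ √(∫ a, f a ^ 2 ∂μ) * √(∫ a, g a ^ 2 ∂μ) := by
    refine le_trans (abs_integral_le_integral_abs) ?_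
    simpa only [abs_mul] using h
  calc (∫ a, f a * g a ∂μ) ^ 2 = |∫ a, f a * g a ∂μ| ^ 2 := (sq_abs _).symm
    _ ≤ (√(∫ a, f a ^ 2 ∂μ) * √(∫ a, g a ^ 2 ∂μ)) ^ 2 := by gcongr
    _ = _ := by
      rw [mul_pow, Real.sq_sqrt (integral_nonneg fun _ => sq_nonneg _),
        Real.sq_sqrt (integral_nonneg fun _ => sq_nonneg _)]

/-- Pointwise decay of the tail integral of a function in a weighted `L²` space. -/
theorem sq_integral_Ioi_le {m : ℝ} (hm : 1 < 2 * m) {f : ℝ → ℝ} (hf : Measurable f)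
    (hint : IntegrableOn (fun s => (1 + s) ^ (2 * m) * f s ^ 2) (Ioi 0)) {η : ℝ} (hη : 0 ≤ η) :
    (∫ s in Ioi η, f s) ^ 2 ≤
      (1 + η) ^ (1 - 2 * m) / (2 * m - 1) * ∫ s in Ioi 0, (1 + s) ^ (2 * m) * f s ^ 2 := by
  have hsub : Ioi η ⊆ Ioi (0 : ℝ) := Ioi_subset_Ioi hη
  have hsq : ∀ (b : ℝ), ∀ s ∈ Ioi η, ((1 + s) ^ b) ^ 2 = (1 + s) ^ (2 * b) := by
    intro b s hs
    have hs' : 0 < s := hsub hs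
    rw [← rpow_mul_natCast (by linarith)]
    congr 1
    push_cast
    ring
  have hw : ∀ s ∈ Ioi η, ((1 + s) ^ (-m)) ^ 2 = (1 + s) ^ (-(2 * m)) := by
    intro s hs
    rw [hsq _ s hs, mul_neg]
  have hg : ∀ s ∈ Ioi η, ((1 + s) ^ m * f s) ^ 2 = (1 + s) ^ (2 * m) * f s ^ 2 := by
    intro s hs
    rw [mul_pow, hsq m s hs]
  have hwL : MemLp (fun s : ℝ => (1 + s) ^ (-m)) 2 (volume.restrict (Ioi η)) := by
    rw [memLp_two_iff_integrable_sq (Measurable.aestronglyMeasurable (by fun_prop))]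
    exact (integrableOn_congr_fun hw measurableSet_Ioi).2
      (integrableOn_Ioi_one_add_rpow (by linarith) hη)
  have hgL : MemLp (fun s : ℝ => (1 + s) ^ m * f s) 2 (volume.restrict (Ioi η)) := by
    rw [memLp_two_iff_integrable_sq (Measurable.aestronglyMeasurable (by fun_prop))]
    exact (integrableOn_congr_fun hg measurableSet_Ioi).2 (hint.mono_set hsub)
  have hprod : ∫ s in Ioi η, f s = ∫ s in Ioi η, (1 + s) ^ (-m) * ((1 + s) ^ m * f s) := by
    refine setIntegral_congr_fun measurableSet_Ioi fun s hs => ?_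
    have hs' : 0 < s := hsub hs
    rw [← mul_assoc, ← rpow_add (by linarith), neg_add_cancel, rpow_zero, one_mul]
  rw [hprod]
  refine (sq_integral_mul_le hwL hgL).trans ?_
  rw [setIntegral_congr_fun measurableSet_Ioi hw, setIntegral_congr_fun measurableSet_Ioi hg,
    integral_Ioi_one_add_rpow (by linarith) hη,
    show -(2 * m) + 1 = 1 - 2 * m by ring, neg_sub]
  refine mul_le_mul_of_nonneg_left (setIntegral_mono_set hint ?_ hsub.eventuallyLE)
    (div_nonneg (rpow_nonneg (by linarith) _) (by linarith))
  filter_upwards [ae_restrict_mem measurableSet_Ioi] with s hs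
  have hs' : 0 < s := hs
  positivity

/-- One-dimensional weighted Hardy-type bound for the tail integral. -/
theorem integral_weighted_sq_tail_le {l l₀ : ℝ} (hl : 0 ≤ l) (hl₀ : 1 < l₀) {f : ℝ → ℝ}
    (hf : Measurable f)
    (hint : IntegrableOn (fun s => (1 + s) ^ (2 * (l + l₀)) * f s ^ 2) (Ioi 0)) :
    ∫ η in Ioi (0 : ℝ), (1 + η) ^ (2 * l) * (∫ s in Ioi η, f s) ^ 2 ≤
      (2 * l₀ - 1)⁻¹ * (2 * l₀ - 2)⁻¹ *
        ∫ s in Ioi 0, (1 + s) ^ (2 * (l + l₀)) * f s ^ 2 := by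
  set G := ∫ s in Ioi (0 : ℝ), (1 + s) ^ (2 * (l + l₀)) * f s ^ 2 with hG
  have hG0 : 0 ≤ G := setIntegral_nonneg measurableSet_Ioi fun s hs => by
    have hs' : 0 < s := hs
    positivity
  have hval : ∫ η in Ioi (0 : ℝ), (1 + η) ^ (1 - 2 * l₀) = (2 * l₀ - 2)⁻¹ := by
    rw [integral_Ioi_one_add_rpow (by linarith) le_rfl, add_zero, one_rpow, one_div]
    congr 1
    ring
  calc ∫ η in Ioi (0 : ℝ), (1 + η) ^ (2 * l) * (∫ s in Ioi η, f s) ^ 2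
      ≤ ∫ η in Ioi (0 : ℝ), (2 * l₀ - 1)⁻¹ * G * (1 + η) ^ (1 - 2 * l₀) := by
        refine integral_mono_of_nonneg ?_
          ((integrableOn_Ioi_one_add_rpow (by linarith) le_rfl).const_mul _) ?_
        · filter_upwards [ae_restrict_mem measurableSet_Ioi] with η hη
          have hη' : 0 < η := hη
          positivity
        · filter_upwards [ae_restrict_mem measurableSet_Ioi] with η hη
          have hη' : 0 < η := hη
          have hden : (2 * (l + l₀) - 1)⁻¹ ≤ (2 * l₀ - 1)⁻¹ :=
            inv_anti₀ (by linarith) (by linarith)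
          have hpow : (1 + η) ^ (2 * l) * (1 + η) ^ (1 - 2 * (l + l₀)) =
              (1 + η) ^ (1 - 2 * l₀) := by
            rw [← rpow_add (by linarith)]
            congr 1
            ring
          calc (1 + η) ^ (2 * l) * (∫ s in Ioi η, f s) ^ 2
              ≤ (1 + η) ^ (2 * l) *
                  ((1 + η) ^ (1 - 2 * (l + l₀)) / (2 * (l + l₀) - 1) * G) := by
                gcongr
                exact sq_integral_Ioi_le (by linarith) hf hint hη'.le
            _ = (2 * (l + l₀) - 1)⁻¹ * G * (1 + η) ^ (1 - 2 * l₀) := by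
                rw [← hpow]
                ring
            _ ≤ _ := by gcongr
    _ = _ := by
        rw [integral_const_mul, hval]
        ring

theorem weighted_L2_bound_of_tail_integral
    (l l₀ : ℝ) (hl : 0 ≤ l) (hl₀ : 1 < l₀)
    (F : ℝ → ℝ → ℝ)
    (hFper : ∀ x η, F (x + 2*π) η = F x η)
    (hFmeas : Measurable (fun q : ℝ × ℝ => F q.1 q.2))
    (hFint : IntegrableOn (fun q : ℝ × ℝ => (1+q.2) ^ (2*(l+l₀)) * (F q.1 q.2)^2)
      ((Ioc (0:ℝ) (2*π)) ×ˢ (Ioi (0:ℝ))) volume) :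
    Real.sqrt (L2wsq l (fun x η => ∫ s in Ioi η, F x s))
      ≤ (2*l₀ - 1) ^ (-(1:ℝ)/2) * (2*l₀ - 2) ^ (-(1:ℝ)/2) *
          Real.sqrt (L2wsq (l + l₀) F) := by
  have hint : Integrable (fun q : ℝ × ℝ => (1 + q.2) ^ (2 * (l + l₀)) * (F q.1 q.2) ^ 2)
      ((volume.restrict (Ioc (0 : ℝ) (2 * π))).prod (volume.restrict (Ioi (0 : ℝ)))) := by
    rw [Measure.prod_restrict]
    exact hFint
  have hsq : L2wsq l (fun x η => ∫ s in Ioi η, F x s) ≤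
      (2 * l₀ - 1)⁻¹ * (2 * l₀ - 2)⁻¹ * L2wsq (l + l₀) F := by
    unfold L2wsq
    rw [← integral_const_mul]
    refine integral_mono_of_nonneg ?_ (hint.integral_prod_left.const_mul _) ?_
    · refine Filter.Eventually.of_forall fun x => ?_
      refine setIntegral_nonneg measurableSet_Ioi fun η hη => ?_
      have hη' : 0 < η := hη
      positivity
    · filter_upwards [hint.prod_right_ae] with x hx
      exact integral_weighted_sq_tail_le hl hl₀ (hFmeas.comp measurable_prodMk_left) hx
  have hroot : ∀ a : ℝ, 0 < a → √(a⁻¹) = a ^ (-(1 : ℝ) / 2) := by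
    intro a ha
    rw [sqrt_eq_rpow, inv_rpow ha.le, ← rpow_neg ha.le, neg_div]
  have h1 : 0 < 2 * l₀ - 1 := by linarith
  have h2 : 0 < 2 * l₀ - 2 := by linarith
  refine (Real.sqrt_le_sqrt hsq).trans_eq ?_
  rw [sqrt_mul (by positivity), sqrt_mul (by positivity), hroot _ h1, hroot _ h2]
end
end

section
/- Let μ, κ, δ be real numbers with 0 < δ < min(μ, κ), and let a ∈ ℝ satisfy a² ≤ 4(μ−δ)(κ−δ)/((μ+κ)² − 4δκ) (note (μ+κ)² − 4δκ > 0). Then for every vector X = (x₁, x₂, x₃, x₄) ∈ ℝ⁴: μ(x₁² + x₂²) + (μ−κ)a(x₁x₃ + x₂x₄) + κ(1−a²)(x₃² + x₄²) ≥ δ(x₁² + x₂² + x₃² + x₄²). Equivalently, the 4×4 block matrix SB = [[μ I₂, (μ−κ)a I₂], [0, κ(1−a²) I₂]] satisfies (SB X)·X ≥ δ|X|² for all X ∈ ℝ⁴. -/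
/-!
STATEMENT 10: positive definiteness of the matrix `SB` of the transformed MHD
remainder system.  If `0 < δ < min(μ,κ)` and
`a² ≤ 4(μ−δ)(κ−δ)/((μ+κ)² − 4δκ)`, then for all `X = (x₁,x₂,x₃,x₄) ∈ ℝ⁴`,
`μ(x₁²+x₂²) + (μ−κ)a(x₁x₃+x₂x₄) + κ(1−a²)(x₃²+x₄²) ≥ δ|X|²`,
i.e. `(SB X)·X ≥ δ|X|²` for `SB = [[μI₂, (μ−κ)aI₂],[0, κ(1−a²)I₂]]`.
-/

/-- A binary quadratic form with positive leading coefficient and nonpositive discriminant is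
nonnegative. -/
theorem binary_quadratic_form_nonneg {p b q : ℝ} (hp : 0 < p) (h : b^2 ≤ 4*p*q) (x z : ℝ) :
    0 ≤ p*x^2 + b*(x*z) + q*z^2 := by
  have key : 0 ≤ 4*p * (p*x^2 + b*(x*z) + q*z^2) := by
    have hz : 0 ≤ (4*p*q - b^2) * z^2 := mul_nonneg (sub_nonneg.2 h) (sq_nonneg z)
    linarith [sq_nonneg (2*p*x + b*z)]
  exact nonneg_of_mul_nonneg_right key (by positivity)

theorem SB_positive_definite
    (μ κ δ a : ℝ) (hδ : 0 < δ) (hδμκ : δ < min μ κ)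
    (hD : 0 < (μ+κ)^2 - 4*δ*κ)
    (ha : a^2 ≤ 4*(μ-δ)*(κ-δ) / ((μ+κ)^2 - 4*δ*κ)) :
    ∀ x₁ x₂ x₃ x₄ : ℝ,
      δ * (x₁^2 + x₂^2 + x₃^2 + x₄^2)
        ≤ μ * (x₁^2 + x₂^2) + (μ-κ) * a * (x₁*x₃ + x₂*x₄)
            + κ * (1 - a^2) * (x₃^2 + x₄^2) := by
  intro x₁ x₂ x₃ x₄
  have hp : 0 < μ - δ := sub_pos.2 (lt_min_iff.1 hδμκ).1
  have hdisc : ((μ-κ)*a)^2 ≤ 4*(μ-δ)*(κ*(1-a^2)-δ) := by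
    rw [le_div_iff₀ hD] at ha
    linarith
  linarith [binary_quadratic_form_nonneg hp hdisc x₁ x₃,
    binary_quadratic_form_nonneg hp hdisc x₂ x₄]
end

section
/- Let χ : ℝ₊ → [0,1] be smooth with χ(y) = 1 for y ∈ [0,1] and χ(y) = 0 for y ≥ 2. Let l ≥ 0, let a, b ∈ L^∞(𝕋), and let G : 𝕋×ℝ₊ → ℝ satisfy ‖G‖_{L²_{1+l}(Ω)} < ∞ and ‖G‖_{L²_l(Ω)} < ∞. Then for every ε ∈ (0, 1]: ‖(1 − χ(y))·(y·a(x) + √ε·b(x))·G(x, y/√ε)‖²_{L²(𝕋×ℝ₊, dx dy)} ≤ 4 ε^{3/2 + l} (‖a‖²_{L^∞(𝕋)} ‖G‖²_{L²_{1+l}(Ω)} + ‖b‖²_{L^∞(𝕋)} ‖G‖²_{L²_l(Ω)}). -/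
/-!
STATEMENT 17: the cut-off scaling estimate of the appendix.
With a smooth cut-off `χ` (`χ = 1` on `[0,1]`, `χ = 0` on `[2,∞)`, `0 ≤ χ ≤ 1`),
`l ≥ 0`, bounded `a, b : 𝕋 → ℝ` and a profile `G` with finite weighted norms,
for every `ε ∈ (0,1]`:
`‖(1−χ(y))(y a(x) + √ε b(x)) G(x, y/√ε)‖²_{L²(𝕋×ℝ₊)}
  ≤ 4 ε^{3/2+l} (‖a‖²_∞ ‖G‖²_{L²_{1+l}} + ‖b‖²_∞ ‖G‖²_{L²_l})`.
(`Ma`, `Mb` are the `L^∞(𝕋)` bounds of `a`, `b`.)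
-/

noncomputable section
open MeasureTheory Set Real

/-- Squared `L²` norm over one `x`-period and the half line `y > 0`. -/
def L2sq (f : ℝ → ℝ → ℝ) : ℝ :=
  ∫ x in Ioc (0:ℝ) (2*π), ∫ y in Ioi (0:ℝ), (f x y)^2

/-- On the support of the cut-off, `s * η > 1`, so powers of `s * (1 + η)` can be inserted. -/
lemma sq_cutoff_mul_le {c α β A B s η l g : ℝ} (hc : 0 ≤ c) (hc' : c ≤ 1)
    (hsupp : s * η ≤ 1 → c = 0) (hα : |α| ≤ A) (hβ : |β| ≤ B) (hs : 0 < s) (hη : 0 < η)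
    (hl : 0 ≤ l) :
    (c * (s * η * α + s * β) * g) ^ 2 ≤ 4 * s ^ (2 + 2 * l) *
      (A ^ 2 * ((1 + η) ^ (2 * (1 + l)) * g ^ 2) + B ^ 2 * ((1 + η) ^ (2 * l) * g ^ 2)) := by
  have h1η : 0 < 1 + η := by linarith
  rcases le_or_gt (s * η) 1 with h | h
  · rw [hsupp h]
    simp only [zero_mul, ne_eq, OfNat.ofNat_ne_zero, not_false_eq_true, zero_pow]
    positivity
  have hα2 : α ^ 2 ≤ A ^ 2 := sq_le_sq' (abs_le.1 hα).1 (abs_le.1 hα).2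
  have hβ2 : β ^ 2 ≤ B ^ 2 := sq_le_sq' (abs_le.1 hβ).1 (abs_le.1 hβ).2
  have hpow : 1 ≤ s ^ (2 * l) * (1 + η) ^ (2 * l) := by
    rw [← Real.mul_rpow hs.le h1η.le]
    exact Real.one_le_rpow (by nlinarith) (by linarith)
  have hs' : s ^ (2 + 2 * l) = s ^ 2 * s ^ (2 * l) := by
    rw [Real.rpow_add hs, Real.rpow_two]
  have hη' : (1 + η) ^ (2 * (1 + l)) = (1 + η) ^ 2 * (1 + η) ^ (2 * l) := by
    rw [mul_add, mul_one, Real.rpow_add h1η, Real.rpow_two]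
  have hc2 : c ^ 2 ≤ 1 := pow_le_one₀ hc hc'
  have hη2 : η ^ 2 ≤ (1 + η) ^ 2 := by nlinarith
  have hsum : (η * α + β) ^ 2 ≤ 2 * ((1 + η) ^ 2 * A ^ 2 + B ^ 2) := by
    have : η ^ 2 * α ^ 2 ≤ (1 + η) ^ 2 * A ^ 2 := by gcongr
    nlinarith [sq_nonneg (η * α - β)]
  have hM : 0 ≤ s ^ 2 * g ^ 2 * (4 * ((1 + η) ^ 2 * A ^ 2 + B ^ 2)) := by positivity
  calc (c * (s * η * α + s * β) * g) ^ 2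
      = c ^ 2 * (s ^ 2 * g ^ 2 * (η * α + β) ^ 2) := by ring
    _ ≤ 1 * (s ^ 2 * g ^ 2 * (4 * ((1 + η) ^ 2 * A ^ 2 + B ^ 2))) := by
      gcongr
      have : 0 ≤ (1 + η) ^ 2 * A ^ 2 + B ^ 2 := by positivity
      linarith
    _ ≤ s ^ (2 * l) * (1 + η) ^ (2 * l) *
        (s ^ 2 * g ^ 2 * (4 * ((1 + η) ^ 2 * A ^ 2 + B ^ 2))) := by gcongr
    _ = _ := by rw [hs', hη']; ring

theorem cutoff_scaling_estimate
    (χ : ℝ → ℝ) (hχsmooth : ContDiff ℝ (⊤ : ℕ∞) χ)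
    (hχrange : ∀ y, 0 ≤ χ y ∧ χ y ≤ 1)
    (hχone : ∀ y ∈ Icc (0:ℝ) 1, χ y = 1)
    (hχzero : ∀ y, 2 ≤ y → χ y = 0)
    (l : ℝ) (hl : 0 ≤ l)
    (a b : ℝ → ℝ) (haper : Function.Periodic a (2*π)) (hbper : Function.Periodic b (2*π))
    (Ma Mb : ℝ) (hMa : ∀ x, |a x| ≤ Ma) (hMb : ∀ x, |b x| ≤ Mb)
    (G : ℝ → ℝ → ℝ) (hGper : ∀ x η, G (x + 2*π) η = G x η)
    (hGmeas : Measurable (fun q : ℝ × ℝ => G q.1 q.2))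
    (hGint₁ : IntegrableOn (fun q : ℝ × ℝ => (1+q.2) ^ (2*(1+l)) * (G q.1 q.2)^2)
      ((Ioc (0:ℝ) (2*π)) ×ˢ (Ioi (0:ℝ))) volume)
    (hGint₂ : IntegrableOn (fun q : ℝ × ℝ => (1+q.2) ^ (2*l) * (G q.1 q.2)^2)
      ((Ioc (0:ℝ) (2*π)) ×ˢ (Ioi (0:ℝ))) volume)
    (ε : ℝ) (hε : ε ∈ Ioc (0:ℝ) 1) :
    L2sq (fun x y => (1 - χ y) * (y * a x + Real.sqrt ε * b x) * G x (y / Real.sqrt ε))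
      ≤ 4 * ε ^ ((3:ℝ)/2 + l) * (Ma^2 * L2wsq (1+l) G + Mb^2 * L2wsq l G) := by
  obtain ⟨hε0, -⟩ := hε
  set s := Real.sqrt ε with hs_def
  have hs : 0 < s := Real.sqrt_pos.2 hε0
  have hεs : ε ^ ((3:ℝ)/2 + l) = s * s ^ (2 + 2 * l) := by
    rw [hs_def, Real.sqrt_eq_rpow, ← Real.rpow_mul hε0.le, ← Real.rpow_add hε0]
    congr 1
    ring
  rw [IntegrableOn, Measure.volume_eq_prod, ← Measure.prod_restrict] at hGint₁ hGint₂
  have hout₁ := hGint₁.integral_prod_left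
  have hout₂ := hGint₂.integral_prod_left
  have hin₁ := hGint₁.prod_right_ae
  have hin₂ := hGint₂.prod_right_ae
  simp only at hout₁ hout₂ hin₁ hin₂
  unfold L2sq L2wsq
  rw [← integral_const_mul, ← integral_const_mul,
    ← integral_add (hout₁.const_mul _) (hout₂.const_mul _), ← integral_const_mul]
  refine integral_mono_of_nonneg
    (Filter.Eventually.of_forall fun x => integral_nonneg fun y => sq_nonneg _)
    (((hout₁.const_mul _).add (hout₂.const_mul _)).const_mul _) ?_
  filter_upwards [hin₁, hin₂] with x h₁ h₂
  rw [← integral_const_mul, ← integral_const_mul,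
    ← integral_add (h₁.const_mul _) (h₂.const_mul _), hεs]
  have hscale := integral_comp_mul_left_Ioi
    (fun y => ((1 - χ y) * (y * a x + s * b x) * G x (y / s)) ^ 2) 0 hs
  rw [mul_zero, smul_eq_mul, eq_inv_mul_iff_mul_eq₀ hs.ne'] at hscale
  rw [← hscale, mul_left_comm 4 s, mul_assoc s]
  refine mul_le_mul_of_nonneg_left ?_ hs.le
  rw [← integral_const_mul]
  refine integral_mono_of_nonneg (Filter.Eventually.of_forall fun y => sq_nonneg _)
    (((h₁.const_mul _).add (h₂.const_mul _)).const_mul _) ?_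
  filter_upwards [ae_restrict_mem measurableSet_Ioi] with η hη
  have hη0 : 0 < η := hη
  simp only [mul_div_cancel_left₀ η hs.ne']
  exact sq_cutoff_mul_le (by linarith [(hχrange (s * η)).2]) (by linarith [(hχrange (s * η)).1])
    (fun h => by rw [hχone _ ⟨by positivity, h⟩, sub_self]) (hMa x) (hMb x) hs hη0 hl
end
end
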